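/- Let $q$ be a prime power and $n$ a positive integer. A $q$-polynomial is $f(x)=\sum_{i=0}^{n-1}a_ix^{q^i}$ with $a_i\in\mathbb F_{q^n}$, taken modulo $x^{q^n}-x$ and identified with the $\mathbb F_q$-linear map of $\mathbb F_{q^n}$ that it induces. For an integer $s\ge 0$ put $f^{[s]}(x)=f(x)^{q^s}=\sum_i a_i^{q^s}x^{q^{i+s}}$ (reduced modulo $x^{q^n}-x$), and for a set $C$ of $q$-polynomials put $C^{[s]}=\{f^{[s]}: f\in C\}$. Two codes $C,C'$ of $q$-polynomials are equivalent if $C'=\{h\circ f^\sigma\circ g: f\in C\}$ for some invertible $q$-polynomials $h,g$ and some automorphism $\sigma$ of $\mathbb F_{q^n}$, where $f^\sigma=\sum_i\sigma(a_i)x^{q^i}$. For $\gcd(s,n)=1$ and $\eta\in\mathbb F_{q^n}$ with $N_{q^n/q}(\eta)\ne(-1)^{nk}$, where $N_{q^n/q}$ is the norm from $\mathbb F_{q^n}$ to $\mathbb F_q$, let $$H_{k,s}(\eta)=\langle x+\eta x^{q^{sk}},\,x^{q^s},\dots,x^{q^{s(k-1)}}\rangle_{\mathbb F_{q^n}}$$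 be the generalized twisted Gabidulin code. Let $2<k\le n-2$ and let $C$ be a $k$-dimensional $\mathbb F_{q^n}$-linear MRD code of $q$-polynomials over $\mathbb F_{q^n}$, i.e. a $k$-dimensional $\mathbb F_{q^n}$-subspace all of whose nonzero elements have rank at least $n-k+1$. Dimensions below are over $\mathbb F_{q^n}$. (A) If $s$ is such that $\gcd(s,n)=1$, $\dim(C\cap C^{[s]})=k-2$ and $\dim(C\cap C^{[s]}\cap C^{[2s]})=k-3$, then there exist $q$-polynomials $p(x),q(x)$ such that $$C=\langle p^{[s]},p^{[2s]},\dots,p^{[s(k-1)]}\rangle_{\mathbb F_{q^n}}\oplus\langle q(x)\rangle_{\mathbb F_{q^n}}.\qquad(*)$$ (B) $C$ is equivalent to a generalized twisted Gabidulin code $H_{k,s}(\eta)$, for some $s$ with $\gcd(s,n)=1$ and some $\eta\neq0$ with $N_{q^n/q}(\eta)\ne(-1)^{nk}$, if and only if there exists $s$ with $\gcd(s,n)=1$ such that: (1) $\dim(C\cap C^{[s]})=k-2$ and $\dim(C\cap C^{[s]}\cap C^{[2s]})=k-3$; and (2) there exist $q$-polynomials $p(x),q(x)$ satisfying $(*)$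 such that $p(x)$ is invertible and $p(x)+\eta\,p(x)^{[sk]}\in C$ for some $\eta\in\mathbb F_{q^n}^*$ with $N_{q^n/q}(\eta)\neq(-1)^{nk}$. -/

import Mathlib

/-! `q`-polynomials over a finite extension `F` of degree `n` of the field `Fq` with `q` elements.
The vector `a : Fin n → F` stands for the `q`-polynomial `∑ i, a i * x ^ (q ^ i)`, and two
`q`-polynomials are identified when they agree modulo `x ^ (q ^ n) - x`. -/

section QPolyDefs

/-- The monomial `x ^ (q ^ m)`, reduced modulo `x ^ (q ^ n) - x`. -/
def qmono (F : Type*) [Field F] (n m : ℕ) : Fin n → F :=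
  fun j => if (j : ℕ) = m % n then 1 else 0

/-- The generalized twisted Gabidulin code (with `h = 0`)
`H_{k,s}(η) = ⟨x + η x^(q^(sk)), x^(q^s), …, x^(q^(s(k-1)))⟩` over `F`. -/
def twistedGabidulin {F : Type*} [Field F] (n k s : ℕ) (η : F) : Submodule F (Fin n → F) :=
  Submodule.span F (insert (qmono F n 0 + η • qmono F n (s * k))
    (Set.range fun i : Fin (k - 1) => qmono F n (s * ((i : ℕ) + 1))))

variable (Fq : Type*) [Field Fq] [Fintype Fq] {F : Type*} [Field F]

/-- The map `F → F` given by the `q`-polynomial with coefficient vector `a`. -/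
def qeval {n : ℕ} (a : Fin n → F) : F → F :=
  fun x => ∑ i : Fin n, a i * x ^ (Fintype.card Fq) ^ (i : ℕ)

/-- The rank of a `q`-polynomial, i.e. the dimension over `Fq` of the image of its map. -/
noncomputable def qrank [Algebra Fq F] {n : ℕ} (a : Fin n → F) : ℕ :=
  Module.finrank Fq (Submodule.span Fq (Set.range (qeval Fq a)))

/-- The power `f^{[s]} = f(x)^(q^s) = ∑ a_i^(q^s) x^(q^(i+s))` of `f = ∑ a_i x^(q^i)`,
reduced modulo `x ^ (q ^ n) - x`. -/
def qfrob {n : ℕ} (s : ℕ) (a : Fin n → F) : Fin n → F :=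
  ∑ i : Fin n, (a i) ^ (Fintype.card Fq) ^ s • qmono F n ((i : ℕ) + s)

/-- The composition `f ∘ g = ∑ a_i g(x)^(q^i)` of `f = ∑ a_i x^(q^i)` and `g`,
reduced modulo `x ^ (q ^ n) - x`. -/
def qcomp {n : ℕ} (a b : Fin n → F) : Fin n → F :=
  ∑ i : Fin n, a i • qfrob Fq (i : ℕ) b

/-- Equivalence of codes of `q`-polynomials: `C' = {u ∘ f^σ ∘ v : f ∈ C}` for invertible
`q`-polynomials `u, v` and an automorphism `σ` of `F`, which acts on the coefficients of `f`. -/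
def CodeEquiv {n : ℕ} (C C' : Set (Fin n → F)) : Prop :=
  ∃ (u v : Fin n → F) (σ : F ≃+* F),
    Function.Bijective (qeval Fq u) ∧ Function.Bijective (qeval Fq v) ∧
    C' = (fun a => qcomp Fq u (qcomp Fq (fun i => σ (a i)) v)) '' C

/-- The span `⟨p^{[s]}, p^{[2s]}, …, p^{[sm]}⟩` over `F`. -/
def qchain {n : ℕ} (s m : ℕ) (p : Fin n → F) : Submodule F (Fin n → F) :=
  Submodule.span F (Set.range fun i : Fin m => qfrob Fq (s * ((i : ℕ) + 1)) p)

variable [Algebra Fq F]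

theorem pow_card_pow_eq (s : ℕ) (x : F) :
    x ^ (Fintype.card Fq) ^ s = ((FiniteField.frobeniusAlgHom Fq F) ^ s) x := by
  induction s generalizing x with
  | zero => simp
  | succ s ih => rw [pow_succ, pow_mul, ih, pow_succ', AlgHom.mul_apply]; simp

theorem qfrob_zero {n : ℕ} (s : ℕ) : qfrob Fq s (0 : Fin n → F) = 0 := by
  simp [qfrob, pow_card_pow_eq]

theorem qfrob_add {n : ℕ} (s : ℕ) (a b : Fin n → F) :
    qfrob Fq s (a + b) = qfrob Fq s a + qfrob Fq s b := by
  simp [qfrob, pow_card_pow_eq, add_smul, Finset.sum_add_distrib]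

theorem qfrob_smul {n : ℕ} (s : ℕ) (c : F) (a : Fin n → F) :
    qfrob Fq s (c • a) = c ^ (Fintype.card Fq) ^ s • qfrob Fq s a := by
  simp [qfrob, mul_pow, mul_smul, Finset.smul_sum]

theorem exists_pow_card_pow_eq [Finite F] (s : ℕ) (c : F) :
    ∃ d : F, d ^ (Fintype.card Fq) ^ s = c := by
  obtain ⟨d, hd⟩ := Finite.surjective_of_injective
    ((FiniteField.frobeniusAlgHom Fq F) ^ s).toRingHom.injective c
  exact ⟨d, by rw [pow_card_pow_eq]; exact hd⟩

/-- The code `C^{[s]} = {f^{[s]} : f ∈ C}`. -/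
def frobCode [Finite F] {n : ℕ} (s : ℕ) (C : Submodule F (Fin n → F)) :
    Submodule F (Fin n → F) where
  carrier := qfrob Fq s '' (C : Set (Fin n → F))
  zero_mem' := ⟨0, C.zero_mem, qfrob_zero Fq s⟩
  add_mem' := by
    rintro _ _ ⟨a, ha, rfl⟩ ⟨b, hb, rfl⟩
    exact ⟨a + b, C.add_mem ha hb, qfrob_add Fq s a b⟩
  smul_mem' := by
    rintro c _ ⟨a, ha, rfl⟩
    obtain ⟨d, rfl⟩ := exists_pow_card_pow_eq Fq s c
    exact ⟨d • a, C.smul_mem d ha, qfrob_smul Fq s d a⟩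

end QPolyDefs

set_option linter.unusedSectionVars false

section QPolyCalculus

open Module

variable (Fq : Type*) [Field Fq] [Fintype Fq] {F : Type*} [Field F]

theorem qmono_eq_single {n m : ℕ} (hn : 0 < n) :
    qmono F n m = Pi.single (⟨m % n, Nat.mod_lt m hn⟩ : Fin n) 1 := by
  ext j
  simp [qmono, Pi.single_apply, Fin.ext_iff]

theorem qeval_add {n : ℕ} (a b : Fin n → F) (x : F) :
    qeval Fq (a + b) x = qeval Fq a x + qeval Fq b x := by
  simp [qeval, add_mul, Finset.sum_add_distrib]

theorem qeval_smul {n : ℕ} (c : F) (a : Fin n → F) (x : F) :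
    qeval Fq (c • a) x = c * qeval Fq a x := by
  simp [qeval, Finset.mul_sum, mul_assoc]

theorem qeval_sum {ι : Type*} {n : ℕ} (t : Finset ι) (a : ι → Fin n → F) (x : F) :
    qeval Fq (∑ i ∈ t, a i) x = ∑ i ∈ t, qeval Fq (a i) x := by
  simp only [qeval, Finset.sum_apply, Finset.sum_mul]
  exact Finset.sum_comm

variable [Algebra Fq F]

theorem add_pow_card_pow (s : ℕ) (x y : F) :
    (x + y) ^ Fintype.card Fq ^ s = x ^ Fintype.card Fq ^ s + y ^ Fintype.card Fq ^ s := by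
  simp [pow_card_pow_eq]

theorem sum_pow_card_pow {ι : Type*} (t : Finset ι) (f : ι → F) (s : ℕ) :
    (∑ i ∈ t, f i) ^ Fintype.card Fq ^ s = ∑ i ∈ t, f i ^ Fintype.card Fq ^ s := by
  simp [pow_card_pow_eq]

variable [Finite F]

theorem pow_card_pow_finrank (x : F) : x ^ Fintype.card Fq ^ finrank Fq F = x := by
  have := Fintype.ofFinite F
  rw [← Module.card_eq_pow_finrank, FiniteField.pow_card]

theorem pow_card_pow_add_mul {n : ℕ} (hn : finrank Fq F = n) (x : F) (m l : ℕ) :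
    x ^ Fintype.card Fq ^ (m + n * l) = x ^ Fintype.card Fq ^ m := by
  subst hn
  induction l with
  | zero => simp
  | succ l ih =>
    rw [mul_add, mul_one, ← add_assoc, pow_add, pow_mul, ih, ← pow_mul, mul_comm, pow_mul,
      pow_card_pow_finrank]

theorem pow_card_pow_mod {n : ℕ} (hn : finrank Fq F = n) (x : F) (m : ℕ) :
    x ^ Fintype.card Fq ^ (m % n) = x ^ Fintype.card Fq ^ m := by
  conv_rhs => rw [← Nat.mod_add_div m n]
  rw [pow_card_pow_add_mul Fq hn]

theorem pow_card_pow_pow (x : F) (i j : ℕ) :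
    (x ^ Fintype.card Fq ^ i) ^ Fintype.card Fq ^ j = x ^ Fintype.card Fq ^ (i + j) := by
  rw [← pow_mul, ← pow_add]

theorem qeval_qmono {n : ℕ} (hn : finrank Fq F = n) (m : ℕ) (x : F) :
    qeval Fq (qmono F n m) x = x ^ Fintype.card Fq ^ m := by
  have hpos : 0 < n := hn ▸ finrank_pos
  rw [qmono_eq_single hpos, qeval, Finset.sum_eq_single ⟨m % n, Nat.mod_lt m hpos⟩]
  · simp [pow_card_pow_mod Fq hn]
  · intro j _ hj
    simp [hj]
  · simp

theorem qeval_injective {n : ℕ} (hn : finrank Fq F = n) :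
    Function.Injective (qeval Fq : (Fin n → F) → F → F) := by
  subst hn
  have hli : LinearIndependent F
      (fun i : Fin (finrank Fq F) => fun x : F => x ^ Fintype.card Fq ^ (i : ℕ)) := by
    have h := (linearIndependent_monoidHom F F).comp
      (fun i : Fin (finrank Fq F) =>
        (((FiniteField.frobeniusAlgHom Fq F) ^ (i : ℕ) : F →ₐ[Fq] F) : F →* F)) (by
        intro i j hij
        refine (FiniteField.bijective_frobeniusAlgHom_pow Fq F).1 ?_
        ext x
        exact DFunLike.congr_fun hij x)
    have he : (fun i : Fin (finrank Fq F) => fun x : F => x ^ Fintype.card Fq ^ (i : ℕ)) =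
        fun i : Fin (finrank Fq F) =>
          ⇑(((FiniteField.frobeniusAlgHom Fq F) ^ (i : ℕ) : F →ₐ[Fq] F) : F →* F) := by
      ext i x
      simp [pow_card_pow_eq]
    rw [he]
    exact h
  intro a b hab
  rw [Fintype.linearIndependent_iff] at hli
  have := hli (a - b) (by
    ext x
    have := congrFun hab x
    simp only [qeval] at this
    simp [sub_mul, Finset.sum_sub_distrib, this])
  ext i
  simpa [sub_eq_zero] using this i

theorem qeval_qfrob {n : ℕ} (hn : finrank Fq F = n) (s : ℕ) (a : Fin n → F) (x : F) :
    qeval Fq (qfrob Fq s a) x = (qeval Fq a x) ^ Fintype.card Fq ^ s := by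
  simp only [qfrob, qeval_sum, qeval_smul, qeval_qmono Fq hn]
  simp only [qeval, sum_pow_card_pow, mul_pow, pow_card_pow_pow]

theorem qeval_qcomp {n : ℕ} (hn : finrank Fq F = n) (a b : Fin n → F) (x : F) :
    qeval Fq (qcomp Fq a b) x = qeval Fq a (qeval Fq b x) := by
  simp only [qcomp, qeval_sum, qeval_smul, qeval_qfrob Fq hn]
  rfl

theorem qeval_map_ringEquiv {n : ℕ} (σ : F ≃+* F) (a : Fin n → F) (x : F) :
    qeval Fq (fun i => σ (a i)) (σ x) = σ (qeval Fq a x) := by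
  simp [qeval]

theorem qfrob_qfrob {n : ℕ} (hn : finrank Fq F = n) (s t : ℕ) (a : Fin n → F) :
    qfrob Fq s (qfrob Fq t a) = qfrob Fq (t + s) a := by
  refine qeval_injective Fq hn (funext fun x => ?_)
  simp only [qeval_qfrob Fq hn, pow_card_pow_pow]

theorem qfrob_mod {n : ℕ} (hn : finrank Fq F = n) (s : ℕ) (a : Fin n → F) :
    qfrob Fq (s % n) a = qfrob Fq s a := by
  refine qeval_injective Fq hn (funext fun x => ?_)
  simp only [qeval_qfrob Fq hn, pow_card_pow_mod Fq hn]

theorem qfrob_zero_left {n : ℕ} (hn : finrank Fq F = n) (a : Fin n → F) : qfrob Fq 0 a = a :=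
  qeval_injective Fq hn (funext fun x => by simp [qeval_qfrob Fq hn])

theorem qfrob_injective {n : ℕ} (hn : finrank Fq F = n) (s : ℕ) :
    Function.Injective (qfrob Fq s : (Fin n → F) → Fin n → F) := by
  intro a b h
  refine qeval_injective Fq hn (funext fun x => ?_)
  have h := congrArg (fun c => qeval Fq c x) h
  simp only [qeval_qfrob Fq hn, pow_card_pow_eq] at h
  exact ((FiniteField.frobeniusAlgHom Fq F) ^ s).toRingHom.injective h

theorem qfrob_surjective {n : ℕ} (hn : finrank Fq F = n) (s : ℕ) :
    Function.Surjective (qfrob Fq s : (Fin n → F) → Fin n → F) :=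
  Finite.surjective_of_injective (qfrob_injective Fq hn s)

theorem qfrob_ringEquiv {n : ℕ} (hn : finrank Fq F = n) (σ : F ≃+* F) (s : ℕ) (a : Fin n → F) :
    qfrob Fq s (fun i => σ (a i)) = fun i => σ (qfrob Fq s a i) := by
  refine qeval_injective Fq hn (funext fun x => ?_)
  obtain ⟨x, rfl⟩ := σ.surjective x
  simp only [qeval_qfrob Fq hn, qeval_map_ringEquiv, map_pow]

/-- A `q`-polynomial that permutes the field has a compositional inverse. -/
theorem exists_qeval_inverse {n : ℕ} (hn : finrank Fq F = n) (u : Fin n → F)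
    (hu : Function.Bijective (qeval Fq u)) :
    ∃ w : Fin n → F, (∀ x, qeval Fq w (qeval Fq u x) = x) ∧
      ∀ x, qeval Fq u (qeval Fq w x) = x := by
  have hiter : ∀ m : ℕ, ∃ w : Fin n → F, qeval Fq w = (qeval Fq u)^[m] := by
    intro m
    induction m with
    | zero => exact ⟨qmono F n 0, funext fun x => by simp [qeval_qmono Fq hn]⟩
    | succ m ih =>
      obtain ⟨w, hw⟩ := ih
      exact ⟨qcomp Fq w u, funext fun x => by simp [qeval_qcomp Fq hn, hw]⟩
  let e : Equiv.Perm F := Equiv.ofBijective _ hu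
  obtain ⟨w, hw⟩ := hiter (orderOf e - 1)
  have hpos : 0 < orderOf e := orderOf_pos e
  have he : ∀ x, (qeval Fq u)^[orderOf e] x = x := by
    intro x
    have h : (e ^ orderOf e) x = x := by simp [pow_orderOf_eq_one]
    rwa [← Equiv.Perm.iterate_eq_pow] at h
  refine ⟨w, fun x => ?_, fun x => ?_⟩
  · rw [hw, ← Function.iterate_succ_apply, Nat.succ_eq_add_one, Nat.sub_add_cancel hpos, he]
  · rw [hw, ← Function.iterate_succ_apply' (qeval Fq u), Nat.succ_eq_add_one, Nat.sub_add_cancel hpos, he]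

end QPolyCalculus

section FrobChains

open Module

variable (Fq : Type*) [Field Fq] [Fintype Fq] {F : Type*} [Field F] [Algebra Fq F] [Finite F]

theorem mem_frobCode {n : ℕ} (s : ℕ) (C : Submodule F (Fin n → F)) (a : Fin n → F) :
    a ∈ frobCode Fq s C ↔ ∃ b ∈ C, qfrob Fq s b = a := Iff.rfl

theorem qfrob_mem_frobCode {n : ℕ} (s : ℕ) {C : Submodule F (Fin n → F)} {a : Fin n → F}
    (ha : a ∈ C) : qfrob Fq s a ∈ frobCode Fq s C := ⟨a, ha, rfl⟩

theorem frobCode_inf {n : ℕ} (hn : finrank Fq F = n) (s : ℕ) (C D : Submodule F (Fin n → F)) :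
    frobCode Fq s (C ⊓ D) = frobCode Fq s C ⊓ frobCode Fq s D := by
  refine SetLike.coe_injective ?_
  exact Set.image_inter (qfrob_injective Fq hn s)

theorem frobCode_frobCode {n : ℕ} (hn : finrank Fq F = n) (s : ℕ) (C : Submodule F (Fin n → F)) :
    frobCode Fq s (frobCode Fq s C) = frobCode Fq (2 * s) C := by
  ext a
  simp only [mem_frobCode, exists_exists_and_eq_and, qfrob_qfrob Fq hn, two_mul]

theorem finrank_frobCode {n : ℕ} (hn : finrank Fq F = n) (s : ℕ) (C : Submodule F (Fin n → F)) :
    finrank F (frobCode Fq s C) = finrank F C := by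
  have h : Nat.card (frobCode Fq s C) = Nat.card C :=
    Nat.card_image_of_injective (qfrob_injective Fq hn s) (C : Set (Fin n → F))
  rw [Module.natCard_eq_pow_finrank (K := F) (V := frobCode Fq s C), Module.natCard_eq_pow_finrank (K := F) (V := C)] at h
  exact Nat.pow_right_injective (Finite.one_lt_card (α := F)) h

theorem qrank_le_one_of_qeval_mem_range {n : ℕ} (a : Fin n → F)
    (h : ∀ x, ∃ y : Fq, qeval Fq a x = algebraMap Fq F y) : qrank Fq a ≤ 1 := by
  have hle : Submodule.span Fq (Set.range (qeval Fq a)) ≤ Submodule.span Fq {(1 : F)} := by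
    rw [Submodule.span_le]
    rintro _ ⟨x, rfl⟩
    obtain ⟨y, hy⟩ := h x
    rw [hy, Algebra.algebraMap_eq_smul_one]
    exact Submodule.smul_mem _ _ (Submodule.mem_span_singleton_self _)
  exact (Submodule.finrank_mono hle).trans (finrank_span_singleton one_ne_zero).le

/-- A code without words of rank one contains no nonzero subcode that is stable under `f ↦ f^{[s]}`
with `s` coprime to `n`. -/
theorem eq_bot_of_le_frobCode {n s : ℕ} (hn : finrank Fq F = n) (hs : Nat.gcd s n = 1)
    (U : Submodule F (Fin n → F)) (hrank : ∀ a ∈ U, a ≠ 0 → 1 < qrank Fq a)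
    (hU : U ≤ frobCode Fq s U) : U = ⊥ := by
  have hpos : 0 < n := hn ▸ finrank_pos
  have heq : U = frobCode Fq s U :=
    Submodule.eq_of_le_of_finrank_eq hU (finrank_frobCode Fq hn s U).symm
  have hstep : ∀ a ∈ U, qfrob Fq s a ∈ U := fun a ha => heq ▸ qfrob_mem_frobCode Fq s ha
  have hmul : ∀ (t : ℕ), ∀ a ∈ U, qfrob Fq (s * t) a ∈ U := by
    intro t
    induction t with
    | zero =>
      intro a ha
      simpa [qfrob_zero_left Fq hn] using ha
    | succ t ih =>
      intro a ha
      rw [mul_add, mul_one, ← qfrob_qfrob Fq hn]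
      exact hstep _ (ih a ha)
  have hall : ∀ (i : ℕ), ∀ a ∈ U, qfrob Fq i a ∈ U := by
    intro i a ha
    obtain ⟨m, hm⟩ := Nat.exists_mul_mod_eq_of_coprime i hs hpos.ne'
    rw [← qfrob_mod Fq hn, ← hm.2, qfrob_mod Fq hn]
    exact hmul m a ha
  rw [Submodule.eq_bot_iff]
  intro f hf
  by_contra hf0
  have hx : ∃ x, qeval Fq f x ≠ 0 := by
    by_contra! h
    exact hf0 (qeval_injective Fq hn (funext fun x => by rw [h]; simp [qeval]))
  obtain ⟨x, hx⟩ := hx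
  obtain ⟨z, hz⟩ := Algebra.trace_surjective Fq F 1
  let g : Fin n → F := ∑ i ∈ Finset.range n, qfrob Fq i ((z / qeval Fq f x) • f)
  have hg : g ∈ U := U.sum_mem fun i _ => hall i _ (U.smul_mem _ hf)
  have hgx : ∀ y, qeval Fq g y =
      algebraMap Fq F (Algebra.trace Fq F (z / qeval Fq f x * qeval Fq f y)) := by
    intro y
    rw [FiniteField.algebraMap_trace_eq_sum_pow, hn, qeval_sum]
    exact Finset.sum_congr rfl fun i _ => by
      rw [qeval_qfrob Fq hn, qeval_smul, Nat.card_eq_fintype_card]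
  have hg0 : g ≠ 0 := by
    intro h0
    have := hgx x
    rw [div_mul_cancel₀ _ hx, hz, h0] at this
    simp [qeval] at this
  have := hrank g hg hg0
  have := qrank_le_one_of_qeval_mem_range Fq g fun y => ⟨_, hgx y⟩
  omega

/-- A chain `g, g^{[s]}, …` of length `m` in `W ∩ W^{[s]}` extends to a chain of length `m + 1`
in `W` that starts one step earlier. -/
theorem exists_chain_extension {n s m : ℕ} (hn : finrank Fq F = n)
    (W : Submodule F (Fin n → F)) (hm : 0 < m)
    (hinv : ∀ U ≤ W, U ≤ frobCode Fq s U → U = ⊥) (g : Fin n → F)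
    (hW : Submodule.span F (Set.range fun i : Fin m => qfrob Fq (s * i) g) ≤ W ⊓ frobCode Fq s W)
    (hfin : finrank F (Submodule.span F (Set.range fun i : Fin m => qfrob Fq (s * i) g)) = m) :
    ∃ g' : Fin n → F,
      Submodule.span F (Set.range fun i : Fin (m + 1) => qfrob Fq (s * i) g') ≤ W ∧
      finrank F (Submodule.span F (Set.range fun i : Fin (m + 1) => qfrob Fq (s * i) g')) =
        m + 1 := by
  set D := Submodule.span F (Set.range fun i : Fin m => qfrob Fq (s * i) g) with hD
  have hmem : ∀ i < m, qfrob Fq (s * i) g ∈ D := fun i hi =>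
    Submodule.subset_span ⟨⟨i, hi⟩, rfl⟩
  have hg : g ∈ D := by simpa [qfrob_zero_left Fq hn] using hmem 0 hm
  obtain ⟨g', hg'W, hg'⟩ := (hW hg).2
  have hshift : ∀ i, qfrob Fq (s * i) g = qfrob Fq (s * (i + 1)) g' := by
    intro i
    rw [← hg', qfrob_qfrob Fq hn, mul_add, mul_one, add_comm]
  refine ⟨g', ?_, ?_⟩
  · rw [Submodule.span_le]
    rintro _ ⟨⟨i, hi⟩, rfl⟩
    rcases i with _ | i
    · simpa [qfrob_zero_left Fq hn] using hg'W
    · have := (hW (hmem i (by omega))).1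
      rwa [hshift] at this
  · set S := Submodule.span F (Set.range fun i : Fin (m + 1) => qfrob Fq (s * i) g') with hS
    have hDS : D ≤ S := by
      rw [hD, Submodule.span_le]
      rintro _ ⟨⟨i, hi⟩, rfl⟩
      exact Submodule.subset_span ⟨⟨i + 1, by omega⟩, (hshift i).symm⟩
    have hg'S : g' ∈ S := Submodule.subset_span ⟨⟨0, by omega⟩, by simp [qfrob_zero_left Fq hn]⟩
    have hg'D : g' ∉ D := by
      intro hcon
      have hle : D ≤ frobCode Fq s D := by
        conv_lhs => rw [hD]
        rw [Submodule.span_le]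
        rintro _ ⟨⟨i, hi⟩, rfl⟩
        refine ⟨qfrob Fq (s * i) g', ?_, ?_⟩
        · rcases i with _ | i
          · simpa [qfrob_zero_left Fq hn] using hcon
          · exact (hshift i) ▸ hmem i (by omega)
        · simp only [qfrob_qfrob Fq hn, hshift, mul_add, mul_one]
      have := hinv D (hW.trans inf_le_left) hle
      rw [this, finrank_bot] at hfin
      omega
    have hlt := Submodule.finrank_lt_finrank_of_lt (lt_of_le_of_ne hDS fun h => hg'D (h ▸ hg'S))
    have hub : finrank F S ≤ m + 1 := by
      simpa [hS, Set.finrank] using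
        finrank_range_le_card (R := F) (fun i : Fin (m + 1) => qfrob Fq (s * i) g')
    omega

/-- A subspace that meets its `s`-th power in codimension one and contains no stable subspace is
spanned by a chain. -/
theorem exists_chain_of_finrank_inf {n s : ℕ} (hn : finrank Fq F = n) (m : ℕ)
    (W : Submodule F (Fin n → F)) (hinv : ∀ U ≤ W, U ≤ frobCode Fq s U → U = ⊥)
    (hW : finrank F W = m + 1) (hWW : finrank F ↥(W ⊓ frobCode Fq s W) = m) :
    ∃ g : Fin n → F,
      Submodule.span F (Set.range fun i : Fin (m + 1) => qfrob Fq (s * i) g) = W := by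
  induction m generalizing W with
  | zero =>
    obtain ⟨g, hg0, hg⟩ := finrank_eq_one_iff'.1 hW
    refine ⟨g, le_antisymm ?_ fun w hw => ?_⟩
    · rw [Submodule.span_le]
      rintro _ ⟨i, rfl⟩
      simp [qfrob_zero_left Fq hn]
    · obtain ⟨c, hc⟩ := hg ⟨w, hw⟩
      have hc' : c • (g : Fin n → F) = w := congrArg Subtype.val hc
      rw [← hc']
      exact Submodule.smul_mem _ _ (Submodule.subset_span ⟨0, by simp [qfrob_zero_left Fq hn]⟩)
  | succ m ih =>
    have hinv' : ∀ U ≤ W ⊓ frobCode Fq s W, U ≤ frobCode Fq s U → U = ⊥ := fun U hU =>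
      hinv U (hU.trans inf_le_left)
    have hsup := Submodule.finrank_sup_add_finrank_inf_eq (W ⊓ frobCode Fq s W)
      (frobCode Fq s (W ⊓ frobCode Fq s W))
    have hle : (W ⊓ frobCode Fq s W) ⊔ frobCode Fq s (W ⊓ frobCode Fq s W) ≤ frobCode Fq s W :=
      sup_le inf_le_right (by rw [frobCode_inf Fq hn]; exact inf_le_left)
    have hle' := Submodule.finrank_mono hle
    rw [finrank_frobCode Fq hn, hW] at hle'
    rw [finrank_frobCode Fq hn, hWW] at hsup
    have hub := Submodule.finrank_mono
      (inf_le_left : (W ⊓ frobCode Fq s W) ⊓ frobCode Fq s (W ⊓ frobCode Fq s W) ≤ _)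
    rw [hWW] at hub
    have hne : finrank F ↥((W ⊓ frobCode Fq s W) ⊓ frobCode Fq s (W ⊓ frobCode Fq s W))
        ≠ m + 1 := by
      intro h
      have heq := Submodule.eq_of_le_of_finrank_eq inf_le_left (h.trans hWW.symm)
      have := hinv' _ le_rfl (inf_eq_left.1 heq)
      rw [this, finrank_bot] at hWW
      omega
    obtain ⟨g, hg⟩ := ih (W ⊓ frobCode Fq s W) hinv' hWW (by omega)
    obtain ⟨g', hg'W, hg'⟩ := exists_chain_extension Fq hn W (Nat.succ_pos m) hinv g hg.le
      (by rw [hg, hWW])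
    exact ⟨g', Submodule.eq_of_le_of_finrank_eq hg'W (hg'.trans hW.symm)⟩

theorem exists_qchain_decomposition {n k s : ℕ} (hn : finrank Fq F = n) (hk : 2 < k)
    (C : Submodule F (Fin n → F)) (hdim : finrank F C = k)
    (hinv : ∀ U ≤ C, U ≤ frobCode Fq s U → U = ⊥)
    (h2 : finrank F ↥(C ⊓ frobCode Fq s C) = k - 2)
    (h3 : finrank F ↥(C ⊓ frobCode Fq s C ⊓ frobCode Fq (2 * s) C) = k - 3) :
    ∃ p q : Fin n → F,
      Disjoint (qchain Fq s (k - 1) p) (Submodule.span F {q}) ∧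
      qchain Fq s (k - 1) p ⊔ Submodule.span F {q} = C := by
  obtain ⟨m, rfl⟩ : ∃ m, k = m + 3 := ⟨k - 3, by omega⟩
  have hinf : (C ⊓ frobCode Fq s C) ⊓ frobCode Fq s (C ⊓ frobCode Fq s C) =
      C ⊓ frobCode Fq s C ⊓ frobCode Fq (2 * s) C := by
    rw [frobCode_inf Fq hn, frobCode_frobCode Fq hn, ← inf_assoc, inf_assoc C, inf_idem]
  obtain ⟨g, hg⟩ := exists_chain_of_finrank_inf Fq (s := s) hn m (C ⊓ frobCode Fq s C)
    (fun U hU => hinv U (hU.trans inf_le_left)) h2 (by rw [hinf]; exact h3)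
  obtain ⟨g', hg'C, hg'⟩ := exists_chain_extension Fq hn C (Nat.succ_pos m) hinv g hg.le
    (by rw [hg]; exact h2)
  obtain ⟨p, hp⟩ := qfrob_surjective Fq hn s g'
  have hchain : qchain Fq s (m + 3 - 1) p =
      Submodule.span F (Set.range fun i : Fin (m + 1 + 1) => qfrob Fq (s * i) g') := by
    rw [qchain, ← hp]
    congr 1
    refine congrArg Set.range (funext fun i => ?_)
    rw [qfrob_qfrob Fq hn, mul_add, mul_one, add_comm]
  rw [← hchain] at hg'C hg'
  have hlt : qchain Fq s (m + 3 - 1) p < C := by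
    refine lt_of_le_of_ne hg'C fun h => ?_
    rw [h, hdim] at hg'
    omega
  obtain ⟨q, hqC, hq⟩ := SetLike.exists_of_lt hlt
  have hq0 : q ≠ 0 := fun h => hq (h ▸ Submodule.zero_mem _)
  have hdis : Disjoint (qchain Fq s (m + 3 - 1) p) (Submodule.span F {q}) :=
    (Submodule.disjoint_span_singleton' hq0).2 hq
  refine ⟨p, q, hdis, Submodule.eq_of_le_of_finrank_eq
    (sup_le hg'C ((Submodule.span_singleton_le_iff_mem _ _).2 hqC)) ?_⟩
  have := Submodule.finrank_sup_add_finrank_inf_eq (qchain Fq s (m + 3 - 1) p)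
    (Submodule.span F {q})
  rw [hdis.eq_bot, finrank_bot, hg', finrank_span_singleton hq0] at this
  omega

end FrobChains

section TwistedCoefficients

open Module

variable (Fq : Type*) [Field Fq] [Fintype Fq] {F : Type*} [Field F]

/-- The coefficient of `x^(q^(sm))` as a linear form. -/
def qcoef {n : ℕ} (hpos : 0 < n) (s m : ℕ) : (Fin n → F) →ₗ[F] F :=
  LinearMap.proj ⟨s * m % n, Nat.mod_lt _ hpos⟩

theorem qcoef_eq_of_modEq {n : ℕ} (hpos : 0 < n) (s : ℕ) {m l : ℕ} (h : m ≡ l [MOD n])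
    (a : Fin n → F) : qcoef hpos s m a = qcoef hpos s l a := by
  have : s * m % n = s * l % n := h.mul_left s
  simp [qcoef, this]

theorem qcoef_qmono {n s : ℕ} (hpos : 0 < n) (hs : Nat.gcd s n = 1) {m i : ℕ} (hm : m < n)
    (hi : i < n) : qcoef hpos s m (qmono F n (s * i)) = if m = i then 1 else 0 := by
  have : s * m % n = s * i % n ↔ m = i := by
    constructor
    · intro h
      have h' : m ≡ i [MOD n] :=
        Nat.ModEq.cancel_left_of_coprime (by rwa [Nat.gcd_comm]) h
      rwa [Nat.ModEq, Nat.mod_eq_of_lt hm, Nat.mod_eq_of_lt hi] at h'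
    · rintro rfl
      rfl
  simp [qcoef, qmono, this]

theorem qcoef_ext {n s : ℕ} (hpos : 0 < n) (hs : Nat.gcd s n = 1) {a b : Fin n → F}
    (h : ∀ m < n, qcoef hpos s m a = qcoef hpos s m b) : a = b := by
  ext j
  obtain ⟨m, hm, hj⟩ := Nat.exists_mul_mod_eq_of_coprime (j : ℕ) hs hpos.ne'
  have := h m hm
  simp only [qcoef, LinearMap.proj_apply] at this
  rw [Nat.mod_eq_of_lt j.2] at hj
  simpa [hj] using this

theorem sum_smul_qmono_apply {n : ℕ} (hpos : 0 < n) (b : Fin n → F) (r t : ℕ) :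
    (∑ i : Fin n, b i • qmono F n (i + t)) ⟨(r + t) % n, Nat.mod_lt _ hpos⟩ =
      b ⟨r % n, Nat.mod_lt _ hpos⟩ := by
  rw [Finset.sum_apply, Finset.sum_eq_single ⟨r % n, Nat.mod_lt _ hpos⟩]
  · simp [qmono]
  · intro i _ hi
    have : ¬ (r + t) % n = (i + t) % n := by
      intro h
      have h' : r ≡ i [MOD n] := Nat.ModEq.add_right_cancel' t h
      rw [Nat.ModEq, Nat.mod_eq_of_lt i.2] at h'
      exact hi (Fin.ext h'.symm)
    simp [qmono, this]
  · simp

/-- The span of the monomials `x^(q^(sm))` with `c ≤ m < c + l`. -/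
def qmonoSpan (F : Type*) [Field F] (n s c l : ℕ) : Submodule F (Fin n → F) :=
  Submodule.span F (Set.range fun i : Fin l => qmono F n (s * (i + c)))

theorem mem_qmonoSpan_iff {n s c l : ℕ} (hpos : 0 < n) (hs : Nat.gcd s n = 1) (hcl : c + l ≤ n)
    (a : Fin n → F) :
    a ∈ qmonoSpan F n s c l ↔ ∀ m < n, m < c ∨ c + l ≤ m → qcoef hpos s m a = 0 := by
  constructor
  · intro ha m hm hmc
    have hle : qmonoSpan F n s c l ≤ LinearMap.ker (qcoef hpos s m) := by
      rw [qmonoSpan, Submodule.span_le]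
      rintro _ ⟨i, rfl⟩
      have := i.2
      simp only [SetLike.mem_coe, LinearMap.mem_ker]
      rw [qcoef_qmono hpos hs hm (by omega), if_neg (by omega)]
    exact hle ha
  · intro h
    have hsum : a = ∑ i : Fin l, qcoef hpos s (i + c) a • qmono F n (s * (i + c)) := by
      refine qcoef_ext hpos hs fun m hm => ?_
      rw [map_sum]
      by_cases hmc : m < c ∨ c + l ≤ m
      · rw [h m hm hmc, Finset.sum_eq_zero]
        intro i _
        have := i.2
        rw [map_smul, qcoef_qmono hpos hs hm (by omega), if_neg (by omega), smul_zero]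
      · push Not at hmc
        rw [Finset.sum_eq_single ⟨m - c, by omega⟩]
        · rw [map_smul, qcoef_qmono hpos hs hm (by dsimp; omega), if_pos (by dsimp; omega)]
          simp [Nat.sub_add_cancel hmc.1]
        · intro i _ hi
          have := i.2
          have : (i : ℕ) ≠ m - c := fun h => hi (Fin.ext h)
          rw [map_smul, qcoef_qmono hpos hs hm (by omega), if_neg (by omega), smul_zero]
        · simp
    rw [hsum]
    exact Submodule.sum_mem _ fun i _ =>
      Submodule.smul_mem _ _ (Submodule.subset_span ⟨i, rfl⟩)

theorem finrank_qmonoSpan {n s c l : ℕ} (hpos : 0 < n) (hs : Nat.gcd s n = 1) (hcl : c + l ≤ n) :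
    finrank F (qmonoSpan F n s c l) = l := by
  have hli : LinearIndependent F fun i : Fin l => qmono F n (s * (i + c)) := by
    rw [Fintype.linearIndependent_iff]
    intro g hg i
    have hi := i.2
    have := congrArg (qcoef hpos s (i + c)) hg
    rw [map_sum, map_zero, Finset.sum_eq_single i] at this
    · rwa [map_smul, qcoef_qmono hpos hs (by omega) (by omega), if_pos rfl, smul_eq_mul,
        mul_one] at this
    · intro j _ hj
      have := j.2
      have : (j : ℕ) ≠ i := fun h => hj (Fin.ext h)
      rw [map_smul, qcoef_qmono hpos hs (by omega) (by omega), if_neg (by omega), smul_zero]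
    · simp
  rw [qmonoSpan, finrank_span_eq_card hli, Fintype.card_fin]

theorem twistedGabidulin_eq_sup (n k s : ℕ) (η : F) :
    twistedGabidulin n k s η =
      qmonoSpan F n s 1 (k - 1) ⊔ Submodule.span F {qmono F n 0 + η • qmono F n (s * k)} := by
  rw [twistedGabidulin, Submodule.span_insert, sup_comm]
  rfl

theorem qcoef_twist {n k s : ℕ} (hpos : 0 < n) (hs : Nat.gcd s n = 1) (hk : k < n) (η : F) {m : ℕ}
    (hm : m < n) : qcoef hpos s m (qmono F n 0 + η • qmono F n (s * k)) =
      (if m = 0 then 1 else 0) + η * if m = k then 1 else 0 := by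
  have h := qcoef_qmono (F := F) hpos hs hm hpos
  rw [mul_zero] at h
  rw [map_add, map_smul, qcoef_qmono hpos hs hm hk, h, smul_eq_mul]

theorem twist_notMem_qmonoSpan {n k s : ℕ} (hs : Nat.gcd s n = 1) (hk : 0 < k) (hkn : k < n)
    (η : F) : qmono F n 0 + η • qmono F n (s * k) ∉ qmonoSpan F n s 1 (k - 1) := by
  have hpos : 0 < n := by omega
  rw [mem_qmonoSpan_iff hpos hs (by omega)]
  intro h
  have := h 0 hpos (Or.inl one_pos)
  rw [qcoef_twist hpos hs hkn η hpos] at this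
  simp [hk.ne] at this

theorem mem_twistedGabidulin_iff {n k s : ℕ} (hpos : 0 < n) (hs : Nat.gcd s n = 1) (hk : 0 < k)
    (hkn : k < n) (η : F) (a : Fin n → F) :
    a ∈ twistedGabidulin n k s η ↔ (∀ m, k < m → m < n → qcoef hpos s m a = 0) ∧
      qcoef hpos s k a = η * qcoef hpos s 0 a := by
  rw [twistedGabidulin_eq_sup, Submodule.mem_sup]
  constructor
  · rintro ⟨b, hb, c, hc, rfl⟩
    obtain ⟨d, rfl⟩ := Submodule.mem_span_singleton.1 hc
    rw [mem_qmonoSpan_iff hpos hs (by omega)] at hb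
    refine ⟨fun m hm hmn => ?_, ?_⟩
    · rw [map_add, map_smul, hb m hmn (by omega), qcoef_twist hpos hs hkn η hmn,
        if_neg (by omega), if_neg (by omega)]
      simp
    · rw [map_add, map_add, map_smul, map_smul, hb k hkn (by omega), hb 0 hpos (by omega),
        qcoef_twist hpos hs hkn η hpos, qcoef_twist hpos hs hkn η hkn, if_neg (by omega),
        if_pos rfl, if_pos rfl, if_neg (by omega)]
      simp [mul_comm]
  · rintro ⟨h1, h2⟩
    refine ⟨a - qcoef hpos s 0 a • (qmono F n 0 + η • qmono F n (s * k)), ?_, _,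
      Submodule.smul_mem _ (qcoef hpos s 0 a) (Submodule.mem_span_singleton_self _), by simp⟩
    rw [mem_qmonoSpan_iff hpos hs (by omega)]
    intro m hm hmc
    rw [map_sub, map_smul, qcoef_twist hpos hs hkn η hm]
    by_cases hm0 : m = 0
    · subst hm0
      rw [if_pos rfl, if_neg (by omega)]
      simp
    · rw [if_neg hm0]
      by_cases hmk : m = k
      · subst hmk
        rw [h2, if_pos rfl]
        simp [mul_comm]
      · rw [h1 m (by omega) hm, if_neg hmk]
        simp

theorem qcoef_qfrob {n : ℕ} (hpos : 0 < n) (s m j : ℕ) (a : Fin n → F) :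
    qcoef hpos s (m + j) (qfrob Fq (s * j) a) = qcoef hpos s m a ^ Fintype.card Fq ^ (s * j) := by
  have := sum_smul_qmono_apply hpos (fun i => a i ^ Fintype.card Fq ^ (s * j)) (s * m) (s * j)
  simp only [qcoef, LinearMap.proj_apply, qfrob, mul_add]
  exact this

variable [Algebra Fq F] [Finite F]

theorem qfrob_qmono {n : ℕ} (hn : finrank Fq F = n) (i j : ℕ) :
    qfrob Fq i (qmono F n j) = qmono F n (i + j) := by
  refine qeval_injective Fq hn (funext fun x => ?_)
  rw [qeval_qfrob Fq hn, qeval_qmono Fq hn, qeval_qmono Fq hn, pow_card_pow_pow, add_comm]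

theorem qcoef_qcomp_qmono {n : ℕ} (hn : finrank Fq F = n) (hpos : 0 < n) (s m i : ℕ)
    (a : Fin n → F) :
    qcoef hpos s (m + i) (qcomp Fq a (qmono F n (s * i))) = qcoef hpos s m a := by
  have := sum_smul_qmono_apply hpos a (s * m) (s * i)
  simp only [qcoef, LinearMap.proj_apply, qcomp, qfrob_qmono Fq hn, mul_add]
  exact this

theorem mem_frobCode_twistedGabidulin_iff {n k s : ℕ} (hn : finrank Fq F = n) (hpos : 0 < n)
    (hs : Nat.gcd s n = 1) (hk : 0 < k) (hkn : k < n) (η : F) (j : ℕ) (a : Fin n → F) :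
    a ∈ frobCode Fq (s * j) (twistedGabidulin n k s η) ↔
      (∀ m, k < m → m < n → qcoef hpos s (m + j) a = 0) ∧
        qcoef hpos s (k + j) a = η ^ Fintype.card Fq ^ (s * j) * qcoef hpos s j a := by
  obtain ⟨b, rfl⟩ := qfrob_surjective Fq hn (s * j) a
  have hmem : qfrob Fq (s * j) b ∈ frobCode Fq (s * j) (twistedGabidulin n k s η) ↔
      b ∈ twistedGabidulin n k s η :=
    ⟨fun ⟨c, hc, h⟩ => qfrob_injective Fq hn _ h ▸ hc, fun h => qfrob_mem_frobCode Fq _ h⟩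
  have hcard : Fintype.card Fq ^ (s * j) ≠ 0 := pow_ne_zero _ Fintype.card_ne_zero
  have hj := qcoef_qfrob Fq hpos s 0 j b
  rw [zero_add] at hj
  rw [hmem, mem_twistedGabidulin_iff hpos hs hk hkn, hj]
  simp only [qcoef_qfrob, pow_eq_zero_iff hcard]
  refine and_congr Iff.rfl ?_
  rw [← mul_pow, pow_card_pow_eq, pow_card_pow_eq]
  exact ((FiniteField.frobeniusAlgHom Fq F) ^ (s * j)).toRingHom.injective.eq_iff.symm

theorem twistedGabidulin_inf_frobCode {n k s : ℕ} (hn : finrank Fq F = n)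
    (hs : Nat.gcd s n = 1) (hk : 2 < k) (hkn : k + 2 ≤ n) {η : F} (hη : η ≠ 0) :
    twistedGabidulin n k s η ⊓ frobCode Fq s (twistedGabidulin n k s η) =
      qmonoSpan F n s 2 (k - 2) := by
  have hpos : 0 < n := by omega
  ext a
  have h1 := mem_frobCode_twistedGabidulin_iff Fq hn hpos hs (k := k) (by omega) (by omega) η 1 a
  rw [mul_one] at h1
  have hn0 : qcoef hpos s n a = qcoef hpos s 0 a := qcoef_eq_of_modEq hpos s (by simp [Nat.ModEq]) a
  rw [Submodule.mem_inf, h1, mem_twistedGabidulin_iff hpos hs (by omega) (by omega),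
    mem_qmonoSpan_iff hpos hs (by omega)]
  constructor
  · rintro ⟨⟨ha, hb⟩, hc, hd⟩
    have h0 : qcoef hpos s 0 a = 0 := by
      have := hc (n - 1) (by omega) (by omega)
      rwa [Nat.sub_add_cancel hpos, hn0] at this
    have h1 : qcoef hpos s 1 a = 0 := by
      rw [ha (k + 1) (by omega) (by omega), eq_comm, mul_eq_zero] at hd
      exact hd.resolve_left (pow_ne_zero _ hη)
    rw [h0, mul_zero] at hb
    intro m hm hmc
    rcases (by omega : m = 0 ∨ m = 1 ∨ m = k ∨ k < m) with rfl | rfl | rfl | h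
    · exact h0
    · exact h1
    · exact hb
    · exact ha m h hm
  · intro h
    refine ⟨⟨fun m hm hmn => h m hmn (by omega), ?_⟩, fun m hm hmn => ?_, ?_⟩
    · rw [h k (by omega) (by omega), h 0 hpos (by omega), mul_zero]
    · rcases (by omega : m + 1 < n ∨ m + 1 = n) with h' | h'
      · exact h _ h' (by omega)
      · rw [h', hn0]
        exact h 0 hpos (by omega)
    · rw [h (k + 1) (by omega) (by omega), h 1 (by omega) (by omega), mul_zero]

theorem twistedGabidulin_inf_frobCode_inf_frobCode {n k s : ℕ} (hn : finrank Fq F = n)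
    (hs : Nat.gcd s n = 1) (hk : 2 < k) (hkn : k + 2 ≤ n) {η : F} (hη : η ≠ 0) :
    twistedGabidulin n k s η ⊓ frobCode Fq s (twistedGabidulin n k s η) ⊓
      frobCode Fq (2 * s) (twistedGabidulin n k s η) = qmonoSpan F n s 3 (k - 3) := by
  have hpos : 0 < n := by omega
  ext a
  have hn0 : qcoef hpos s n a = qcoef hpos s 0 a := qcoef_eq_of_modEq hpos s (by simp [Nat.ModEq]) a
  have hn1 : qcoef hpos s (n + 1) a = qcoef hpos s 1 a :=
    qcoef_eq_of_modEq hpos s (by simp [Nat.ModEq]) a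
  rw [twistedGabidulin_inf_frobCode Fq hn hs hk hkn hη, Submodule.mem_inf, mul_comm 2 s,
    mem_frobCode_twistedGabidulin_iff Fq hn hpos hs (by omega) (by omega),
    mem_qmonoSpan_iff hpos hs (by omega), mem_qmonoSpan_iff hpos hs (by omega)]
  have hk2 : (∀ m < n, m < 2 ∨ 2 + (k - 2) ≤ m → qcoef hpos s m a = 0) →
      qcoef hpos s (k + 2) a = 0 := by
    intro h
    rcases (by omega : k + 2 < n ∨ k + 2 = n) with h' | h'
    · exact h _ h' (by omega)
    · rw [h', hn0]
      exact h 0 hpos (by omega)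
  constructor
  · rintro ⟨ha, -, hb⟩
    rw [hk2 ha, eq_comm, mul_eq_zero] at hb
    intro m hm hmc
    rcases (by omega : m = 2 ∨ (m < 2 ∨ 2 + (k - 2) ≤ m)) with rfl | h
    · exact hb.resolve_left (pow_ne_zero _ hη)
    · exact ha m hm h
  · intro h
    have h' : ∀ m < n, m < 2 ∨ 2 + (k - 2) ≤ m → qcoef hpos s m a = 0 := fun m hm hmc =>
      h m hm (by omega)
    refine ⟨h', fun m hm hmn => ?_, ?_⟩
    · rcases (by omega : m + 2 < n ∨ m + 2 = n ∨ m + 2 = n + 1) with h1 | h1 | h1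
      · exact h _ h1 (by omega)
      · rw [h1, hn0]
        exact h 0 hpos (by omega)
      · rw [h1, hn1]
        exact h 1 (by omega) (by omega)
    · rw [hk2 h', h 2 (by omega) (by omega), mul_zero]

/-- The left idealiser of a twisted Gabidulin code consists of the maps `x ↦ b x`. -/
theorem qeval_eq_mul_of_qcomp_mem_twistedGabidulin {n k s : ℕ} (hn : finrank Fq F = n)
    (hs : Nat.gcd s n = 1) (hk : 2 < k) (hkn : k + 2 ≤ n) {η : F} (hη : η ≠ 0) (a : Fin n → F)
    (h : ∀ f ∈ twistedGabidulin n k s η, qcomp Fq a f ∈ twistedGabidulin n k s η) :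
    ∃ b : F, ∀ x, qeval Fq a x = b * x := by
  have hpos : 0 < n := by omega
  have hmono : ∀ i, 0 < i → i < k →
      (∀ m, k < m → m < n → qcoef hpos s m (qcomp Fq a (qmono F n (s * i))) = 0) ∧
      qcoef hpos s k (qcomp Fq a (qmono F n (s * i))) =
        η * qcoef hpos s 0 (qcomp Fq a (qmono F n (s * i))) := by
    intro i hi hik
    rw [← mem_twistedGabidulin_iff hpos hs (by omega) (by omega)]
    refine h _ (Submodule.subset_span (Or.inr ⟨⟨i - 1, by omega⟩, ?_⟩))
    simp only [Nat.sub_add_cancel hi]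
  have hmid : ∀ m, 2 ≤ m → m + 2 ≤ n → qcoef hpos s m a = 0 := by
    intro m hm hmn
    by_cases hmk : m ≤ k
    · rw [← qcoef_qcomp_qmono Fq hn hpos s m (k + 1 - m)]
      exact (hmono _ (by omega) (by omega)).1 _ (by omega) (by omega)
    · rw [← qcoef_qcomp_qmono Fq hn hpos s m 1]
      exact (hmono _ (by omega) (by omega)).1 _ (by omega) (by omega)
  have h0 : ∀ i, 0 < i → i < n → qcoef hpos s 0 (qcomp Fq a (qmono F n (s * i))) =
      qcoef hpos s (n - i) a := by
    intro i hi hin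
    rw [← qcoef_qcomp_qmono Fq hn hpos s (n - i) i, Nat.sub_add_cancel hin.le]
    exact qcoef_eq_of_modEq hpos s (by simp [Nat.ModEq]) _
  have h1 : qcoef hpos s 1 a = 0 := by
    have := (hmono (k - 1) (by omega) (by omega)).2
    rw [h0 _ (by omega) (by omega), hmid (n - (k - 1)) (by omega) (by omega), mul_zero] at this
    rw [← qcoef_qcomp_qmono Fq hn hpos s 1 (k - 1), ← this]
    congr 2
    omega
  have hlast : qcoef hpos s (n - 1) a = 0 := by
    have := (hmono 1 (by omega) (by omega)).2
    have hk1 := qcoef_qcomp_qmono Fq hn hpos s (k - 1) 1 a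
    rw [Nat.sub_add_cancel (by omega : 1 ≤ k), this, h0 1 (by omega) (by omega),
      hmid (k - 1) (by omega) (by omega), mul_eq_zero] at hk1
    exact hk1.resolve_left hη
  have ha : a = qcoef hpos s 0 a • qmono F n (s * 0) := by
    refine qcoef_ext hpos hs fun m hm => ?_
    rw [map_smul, qcoef_qmono hpos hs hm hpos]
    rcases (by omega : m = 0 ∨ m = 1 ∨ m = n - 1 ∨ (2 ≤ m ∧ m + 2 ≤ n)) with
      rfl | rfl | rfl | ⟨h2, h3⟩
    · simp
    · simp [h1]
    · rw [hlast, if_neg (by omega), smul_zero]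
    · rw [hmid m h2 h3, if_neg (by omega), smul_zero]
  refine ⟨qcoef hpos s 0 a, fun x => ?_⟩
  conv_lhs => rw [ha]
  rw [qeval_smul, qeval_qmono Fq hn]
  simp

end TwistedCoefficients

section TwistedEquivalence

open Module

variable (Fq : Type*) [Field Fq] [Fintype Fq] {F : Type*} [Field F]

/-- Right composition `f ↦ f ∘ p` as a linear map. -/
def qcompRight {n : ℕ} (p : Fin n → F) : (Fin n → F) →ₗ[F] (Fin n → F) where
  toFun a := qcomp Fq a p
  map_add' a b := by simp [qcomp, add_smul, Finset.sum_add_distrib]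
  map_smul' c a := by simp [qcomp, mul_smul, Finset.smul_sum]

variable [Algebra Fq F] [Finite F]

theorem qeval_qcompRight {n : ℕ} (hn : finrank Fq F = n) (p a : Fin n → F) (x : F) :
    qeval Fq (qcompRight Fq p a) x = qeval Fq a (qeval Fq p x) :=
  qeval_qcomp Fq hn a p x

theorem qcompRight_injective {n : ℕ} (hn : finrank Fq F = n) (p : Fin n → F)
    (hp : Function.Bijective (qeval Fq p)) : Function.Injective (qcompRight Fq p) := by
  intro a b h
  refine qeval_injective Fq hn (funext fun x => ?_)
  obtain ⟨y, rfl⟩ := hp.2 x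
  rw [← qeval_qcompRight Fq hn, ← qeval_qcompRight Fq hn, h]

theorem qcompRight_qmono {n : ℕ} (hn : finrank Fq F = n) (p : Fin n → F) (m : ℕ) :
    qcompRight Fq p (qmono F n m) = qfrob Fq m p := by
  refine qeval_injective Fq hn (funext fun x => ?_)
  rw [qeval_qcompRight Fq hn, qeval_qmono Fq hn, qeval_qfrob Fq hn]

theorem qcompRight_qfrob {n : ℕ} (hn : finrank Fq F = n) (p a : Fin n → F) (s : ℕ) :
    qcompRight Fq p (qfrob Fq s a) = qfrob Fq s (qcompRight Fq p a) := by
  refine qeval_injective Fq hn (funext fun x => ?_)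
  simp only [qeval_qcompRight Fq hn, qeval_qfrob Fq hn]

theorem map_qcompRight_frobCode {n : ℕ} (hn : finrank Fq F = n) (p : Fin n → F) (s : ℕ)
    (C : Submodule F (Fin n → F)) :
    (frobCode Fq s C).map (qcompRight Fq p) = frobCode Fq s (C.map (qcompRight Fq p)) := by
  ext a
  simp only [Submodule.mem_map, mem_frobCode, exists_exists_and_eq_and, qcompRight_qfrob Fq hn]

theorem finrank_map_qcompRight {n : ℕ} (hn : finrank Fq F = n) (p : Fin n → F)
    (hp : Function.Bijective (qeval Fq p)) (C : Submodule F (Fin n → F)) :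
    finrank F (C.map (qcompRight Fq p)) = finrank F C :=
  (Submodule.equivMapOfInjective _ (qcompRight_injective Fq hn p hp) C).finrank_eq.symm

theorem map_qcompRight_qmonoSpan {n : ℕ} (hn : finrank Fq F = n) (p : Fin n → F) (s l : ℕ) :
    (qmonoSpan F n s 1 l).map (qcompRight Fq p) = qchain Fq s l p := by
  rw [qmonoSpan, Submodule.map_span, ← Set.range_comp, qchain]
  congr 2
  exact funext fun i => qcompRight_qmono Fq hn p _

theorem qcompRight_twist {n : ℕ} (hn : finrank Fq F = n) (p : Fin n → F) (m : ℕ) (η : F) :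
    qcompRight Fq p (qmono F n 0 + η • qmono F n m) = p + η • qfrob Fq m p := by
  rw [map_add, map_smul, qcompRight_qmono Fq hn, qcompRight_qmono Fq hn, qfrob_zero_left Fq hn]

theorem map_qcompRight_twistedGabidulin {n : ℕ} (hn : finrank Fq F = n) (p : Fin n → F)
    (k s : ℕ) (η : F) : (twistedGabidulin n k s η).map (qcompRight Fq p) =
      qchain Fq s (k - 1) p ⊔ Submodule.span F {p + η • qfrob Fq (s * k) p} := by
  rw [twistedGabidulin_eq_sup, Submodule.map_sup, map_qcompRight_qmonoSpan Fq hn,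
    Submodule.map_span, Set.image_singleton, qcompRight_twist Fq hn]

theorem disjoint_qchain_twist {n k s : ℕ} (hn : finrank Fq F = n) (hs : Nat.gcd s n = 1)
    (hk : 0 < k) (hkn : k < n) (p : Fin n → F) (hp : Function.Bijective (qeval Fq p)) (η : F) :
    Disjoint (qchain Fq s (k - 1) p) (Submodule.span F {p + η • qfrob Fq (s * k) p}) := by
  have hnot : p + η • qfrob Fq (s * k) p ∉ qchain Fq s (k - 1) p := by
    rw [← map_qcompRight_qmonoSpan Fq hn, ← qcompRight_twist Fq hn]
    rintro ⟨a, ha, h⟩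
    rw [qcompRight_injective Fq hn p hp h] at ha
    exact twist_notMem_qmonoSpan hs hk hkn η ha
  have h0 : p + η • qfrob Fq (s * k) p ≠ 0 := fun h => hnot (by rw [h]; exact zero_mem _)
  exact (Submodule.disjoint_span_singleton' h0).2 hnot

theorem finrank_qchain_sup_twist {n k s : ℕ} (hn : finrank Fq F = n) (hs : Nat.gcd s n = 1)
    (hk : 0 < k) (hkn : k < n) (p : Fin n → F) (hp : Function.Bijective (qeval Fq p)) (η : F) :
    finrank F ↥(qchain Fq s (k - 1) p ⊔ Submodule.span F {p + η • qfrob Fq (s * k) p}) = k := by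
  have hdis := disjoint_qchain_twist Fq hn hs hk hkn p hp η
  have hq0 : p + η • qfrob Fq (s * k) p ≠ 0 := by
    rw [← qcompRight_twist Fq hn]
    intro h
    refine twist_notMem_qmonoSpan hs hk hkn η ?_
    rw [qcompRight_injective Fq hn p hp (h.trans (map_zero _).symm)]
    exact Submodule.zero_mem _
  have := Submodule.finrank_sup_add_finrank_inf_eq (qchain Fq s (k - 1) p)
    (Submodule.span F {p + η • qfrob Fq (s * k) p})
  rw [hdis.eq_bot, finrank_bot, finrank_span_singleton hq0, ← map_qcompRight_qmonoSpan Fq hn,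
    finrank_map_qcompRight Fq hn p hp, finrank_qmonoSpan (by omega) hs (by omega),
    map_qcompRight_qmonoSpan Fq hn] at this
  omega

theorem codeEquiv_twistedGabidulin {n k s : ℕ} (hn : finrank Fq F = n) (p : Fin n → F)
    (hp : Function.Bijective (qeval Fq p)) (η : F) :
    CodeEquiv Fq ((twistedGabidulin n k s η).map (qcompRight Fq p) : Set (Fin n → F))
      (twistedGabidulin n k s η : Set (Fin n → F)) := by
  obtain ⟨w, hw1, hw2⟩ := exists_qeval_inverse Fq hn p hp
  have hid : ∀ x, qeval Fq (qmono F n 0) x = x := fun x => by simp [qeval_qmono Fq hn]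
  have hcomp : ∀ a : Fin n → F, qcomp Fq (qmono F n 0)
      (qcomp Fq (fun i => RingEquiv.refl F (qcompRight Fq p a i)) w) = a := by
    intro a
    refine qeval_injective Fq hn (funext fun x => ?_)
    rw [qeval_qcomp Fq hn, hid, qeval_qcomp Fq hn]
    simp only [RingEquiv.refl_apply]
    rw [qeval_qcompRight Fq hn, hw2]
  refine ⟨qmono F n 0, w, RingEquiv.refl F, ?_, ?_, ?_⟩
  · rw [show qeval Fq (qmono F n 0) = id from funext hid]
    exact Function.bijective_id
  · exact Function.bijective_iff_has_inverse.2 ⟨qeval Fq p, hw2, hw1⟩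
  · rw [Submodule.map_coe, Set.image_image]
    simp only [hcomp, Set.image_id']

/-- The left factor of an equivalence from a linear code onto a twisted Gabidulin code is a
monomial. -/
theorem exists_monomial_of_twistedGabidulin_eq_image {n k s : ℕ} (hn : finrank Fq F = n)
    (hs : Nat.gcd s n = 1) (hk : 2 < k) (hkn : k + 2 ≤ n) {η : F} (hη : η ≠ 0)
    (C : Submodule F (Fin n → F)) (u v : Fin n → F) (σ : F ≃+* F)
    (hu : Function.Bijective (qeval Fq u))
    (hC : (twistedGabidulin n k s η : Set (Fin n → F)) =
      (fun a => qcomp Fq u (qcomp Fq (fun i => σ (a i)) v)) '' (C : Set (Fin n → F))) :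
    ∃ (j : ℕ) (α : F), j < n ∧ ∀ x, qeval Fq u x = α * x ^ Fintype.card Fq ^ j := by
  obtain ⟨w, hw1, hw2⟩ := exists_qeval_inverse Fq hn u hu
  have hsemi : ∀ a : F, ∃ b : F, ∀ x, qeval Fq u (a * x) = b * qeval Fq u x := by
    intro a
    obtain ⟨b, hb⟩ := qeval_eq_mul_of_qcomp_mem_twistedGabidulin Fq hn hs hk hkn hη
      (qcomp Fq u (a • w)) (by
        intro f hf
        rw [← SetLike.mem_coe, hC] at hf ⊢
        obtain ⟨c, hc, rfl⟩ := hf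
        refine ⟨σ.symm a • c, C.smul_mem _ hc, ?_⟩
        refine qeval_injective Fq hn (funext fun x => ?_)
        have hsm : (fun i => σ ((σ.symm a • c) i)) = a • fun i => σ (c i) := by
          ext i
          simp
        simp only [hsm, qeval_qcomp Fq hn, qeval_smul, hw1])
    refine ⟨b, fun x => ?_⟩
    have := hb (qeval Fq u x)
    rwa [qeval_qcomp Fq hn, qeval_smul, hw1] at this
  have hu0 : ∃ j, u j ≠ 0 := by
    by_contra! h
    have h1 : qeval Fq u 1 = qeval Fq u 0 := by simp [qeval, h]
    exact one_ne_zero (hu.1 h1)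
  obtain ⟨j, hj⟩ := hu0
  have hmul : ∀ a x : F, qeval Fq u (a * x) = a ^ Fintype.card Fq ^ (j : ℕ) * qeval Fq u x := by
    intro a x
    obtain ⟨b, hb⟩ := hsemi a
    have heq : (fun i => u i * a ^ Fintype.card Fq ^ (i : ℕ)) = b • u := by
      refine qeval_injective Fq hn (funext fun y => ?_)
      rw [qeval_smul, ← hb]
      simp [qeval, mul_pow, mul_assoc]
    have hbj := congrFun heq j
    simp only [Pi.smul_apply, smul_eq_mul] at hbj
    rw [mul_comm] at hbj
    rw [hb, mul_right_cancel₀ hj hbj]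
  refine ⟨j, qeval Fq u 1, j.2, fun x => ?_⟩
  have := hmul x 1
  rwa [mul_one, mul_comm] at this

theorem algebraMap_norm_map_ringEquiv (σ : F ≃+* F) (x : F) :
    algebraMap Fq F (Algebra.norm Fq (σ x)) = σ (algebraMap Fq F (Algebra.norm Fq x)) := by
  simp [FiniteField.algebraMap_norm_eq_prod_pow]

theorem norm_pow_card_pow (t : ℕ) (x : F) :
    Algebra.norm Fq (x ^ Fintype.card Fq ^ t) = Algebra.norm Fq x := by
  rw [map_pow, FiniteField.pow_card_pow]

/-- A linear code equivalent to `H_{k,s}(η)` has the form `H_{k,s}(η') ∘ p` with `p` invertible. -/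
theorem exists_eq_map_qcompRight_of_codeEquiv {n k s : ℕ} (hn : finrank Fq F = n)
    (hs : Nat.gcd s n = 1) (hk : 2 < k) (hkn : k + 2 ≤ n) {η : F} (hη : η ≠ 0)
    (hnorm : Algebra.norm Fq η ≠ (-1 : Fq) ^ (n * k)) (C : Submodule F (Fin n → F))
    (hdim : finrank F C = k)
    (hC : CodeEquiv Fq (C : Set (Fin n → F)) (twistedGabidulin n k s η : Set (Fin n → F))) :
    ∃ (p : Fin n → F) (η' : F), Function.Bijective (qeval Fq p) ∧ η' ≠ 0 ∧
      Algebra.norm Fq η' ≠ (-1 : Fq) ^ (n * k) ∧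
      C = (twistedGabidulin n k s η').map (qcompRight Fq p) := by
  obtain ⟨u, v, σ, hu, hv, hC⟩ := hC
  obtain ⟨j, α, hj, huα⟩ :=
    exists_monomial_of_twistedGabidulin_eq_image Fq hn hs hk hkn hη C u v σ hu hC
  obtain ⟨w, hw1, hw2⟩ := exists_qeval_inverse Fq hn v hv
  let t := n - j
  have hjt : ∀ x : F, (x ^ Fintype.card Fq ^ j) ^ Fintype.card Fq ^ t = x := by
    intro x
    rw [pow_card_pow_pow, Nat.add_sub_cancel' hj.le, ← hn, pow_card_pow_finrank]
  have hinj : ∀ x y : F, x ^ Fintype.card Fq ^ t = y ^ Fintype.card Fq ^ t → x = y := by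
    intro x y h
    rw [pow_card_pow_eq, pow_card_pow_eq] at h
    exact ((FiniteField.frobeniusAlgHom Fq F) ^ t).toRingHom.injective h
  -- a word `f` of the twisted code comes from the word `u⁻¹ ∘ f ∘ v⁻¹`
  have key : ∀ f ∈ twistedGabidulin n k s η, ∀ d : Fin n → F,
      (∀ x, qeval Fq d x = qeval Fq f (qeval Fq w x) ^ Fintype.card Fq ^ t) →
      (fun i => σ.symm (d i)) ∈ C := by
    intro f hf d hd
    rw [← SetLike.mem_coe, hC] at hf
    obtain ⟨c, hc, rfl⟩ := hf
    have hdc : d = (α ^ Fintype.card Fq ^ t) • fun i => σ (c i) := by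
      refine qeval_injective Fq hn (funext fun x => ?_)
      rw [hd, qeval_smul, qeval_qcomp Fq hn, qeval_qcomp Fq hn, hw2, huα, mul_pow, hjt]
    have : (fun i => σ.symm (d i)) = σ.symm (α ^ Fintype.card Fq ^ t) • c := by
      ext i
      simp [hdc]
    rw [this]
    exact C.smul_mem _ hc
  let p : Fin n → F := fun i => σ.symm (qfrob Fq t w i)
  let η' : F := σ.symm (η ^ Fintype.card Fq ^ t)
  have hpeval : ∀ x, qeval Fq p (σ.symm x) = σ.symm (qeval Fq w x ^ Fintype.card Fq ^ t) := by
    intro x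
    rw [qeval_map_ringEquiv, qeval_qfrob Fq hn]
  have hp : Function.Bijective (qeval Fq p) := by
    rw [← Finite.injective_iff_bijective]
    intro x y hxy
    obtain ⟨x, rfl⟩ := σ.symm.surjective x
    obtain ⟨y, rfl⟩ := σ.symm.surjective y
    rw [hpeval, hpeval] at hxy
    have := hinj _ _ (σ.symm.injective hxy)
    rw [← hw2 x, this, hw2]
  refine ⟨p, η', hp, ?_, fun h => hnorm ?_, ?_⟩
  · simpa [η'] using hη
  · have h2 := algebraMap_norm_map_ringEquiv Fq σ.symm (η ^ Fintype.card Fq ^ t)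
    rw [norm_pow_card_pow, show Algebra.norm Fq (σ.symm (η ^ Fintype.card Fq ^ t)) = _ from h,
      eq_comm, RingEquiv.symm_apply_eq] at h2
    refine (algebraMap Fq F).injective ?_
    rw [h2]
    simp
  · rw [map_qcompRight_twistedGabidulin Fq hn]
    refine (Submodule.eq_of_le_of_finrank_eq (sup_le ?_ ?_) ?_).symm
    · rw [qchain, Submodule.span_le]
      rintro _ ⟨i, rfl⟩
      simp only [SetLike.mem_coe, p, qfrob_ringEquiv Fq hn]
      refine key (qmono F n (s * (i + 1))) (Submodule.subset_span (Or.inr ⟨i, rfl⟩)) _ fun x => ?_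
      rw [qeval_qfrob Fq hn, qeval_qfrob Fq hn, qeval_qmono Fq hn, pow_card_pow_pow,
        pow_card_pow_pow, add_comm]
    · rw [Submodule.span_singleton_le_iff_mem]
      have heq : p + η' • qfrob Fq (s * k) p = fun i => σ.symm
          ((qfrob Fq t w + η ^ Fintype.card Fq ^ t • qfrob Fq (s * k) (qfrob Fq t w)) i) := by
        simp only [p, η', qfrob_ringEquiv Fq hn]
        ext i
        simp
      rw [heq]
      refine key _ (Submodule.subset_span (Or.inl rfl)) _ fun x => ?_
      rw [qeval_add, qeval_smul, qeval_add, qeval_smul, qeval_qmono Fq hn, qeval_qmono Fq hn,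
        qeval_qfrob Fq hn, qeval_qfrob Fq hn, qeval_qfrob Fq hn, add_pow_card_pow, mul_pow,
        pow_card_pow_pow, pow_card_pow_pow, pow_card_pow_pow, add_comm t, zero_add]
    · rw [finrank_qchain_sup_twist Fq hn hs (by omega) (by omega) p hp, hdim]

end TwistedEquivalence

theorem twisted_gabidulin_characterization
    (Fq F : Type*) [Field Fq] [Fintype Fq] [Field F] [Finite F] [Algebra Fq F]
    (n k : ℕ) (hn : Module.finrank Fq F = n) (hk : 2 < k) (hkn : k + 2 ≤ n)
    (C : Submodule F (Fin n → F))
    (hdim : Module.finrank F C = k)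
    (hMRD : ∀ a ∈ C, a ≠ 0 → n - k + 1 ≤ qrank Fq a) :
    -- the two dimension conditions force the decomposition of `C`
    (∀ s : ℕ, Nat.gcd s n = 1 →
      Module.finrank F ↥(C ⊓ frobCode Fq s C) = k - 2 →
      Module.finrank F ↥(C ⊓ frobCode Fq s C ⊓ frobCode Fq (2 * s) C) = k - 3 →
      ∃ p q : Fin n → F,
        Disjoint (qchain Fq s (k - 1) p) (Submodule.span F {q}) ∧
        qchain Fq s (k - 1) p ⊔ Submodule.span F {q} = C) ∧
    -- the characterization
    ((∃ (s : ℕ) (η : F), Nat.gcd s n = 1 ∧ η ≠ 0 ∧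
        Algebra.norm Fq η ≠ (-1 : Fq) ^ (n * k) ∧
        CodeEquiv Fq (C : Set (Fin n → F)) (twistedGabidulin n k s η : Set (Fin n → F))) ↔
      (∃ s : ℕ, Nat.gcd s n = 1 ∧
        Module.finrank F ↥(C ⊓ frobCode Fq s C) = k - 2 ∧
        Module.finrank F ↥(C ⊓ frobCode Fq s C ⊓ frobCode Fq (2 * s) C) = k - 3 ∧
        ∃ p q : Fin n → F,
          Disjoint (qchain Fq s (k - 1) p) (Submodule.span F {q}) ∧
          qchain Fq s (k - 1) p ⊔ Submodule.span F {q} = C ∧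
          Function.Bijective (qeval Fq p) ∧
          ∃ η : F, η ≠ 0 ∧ Algebra.norm Fq η ≠ (-1 : Fq) ^ (n * k) ∧
            p + η • qfrob Fq (s * k) p ∈ C)) := by
  refine ⟨fun s hs h2 h3 => exists_qchain_decomposition Fq hn hk C hdim
    (fun U hU => eq_bot_of_le_frobCode Fq hn hs U fun a ha ha0 => ?_) h2 h3, ?_, ?_⟩
  · have := hMRD a (hU ha) ha0
    omega
  · rintro ⟨s, η, hs, hη, hnorm, hC⟩
    obtain ⟨p, η', hp, hη', hnorm', rfl⟩ :=
      exists_eq_map_qcompRight_of_codeEquiv Fq hn hs hk hkn hη hnorm C hdim hC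
    have hinj := qcompRight_injective Fq hn p hp
    refine ⟨s, hs, ?_, ?_, p, p + η' • qfrob Fq (s * k) p,
      disjoint_qchain_twist Fq hn hs (by omega) (by omega) p hp η',
      (map_qcompRight_twistedGabidulin Fq hn p k s η').symm, hp, η', hη', hnorm', ?_⟩
    · rw [← map_qcompRight_frobCode Fq hn, ← Submodule.map_inf _ hinj,
        finrank_map_qcompRight Fq hn p hp, twistedGabidulin_inf_frobCode Fq hn hs hk hkn hη',
        finrank_qmonoSpan (by omega) hs (by omega)]
    · rw [← map_qcompRight_frobCode Fq hn, ← map_qcompRight_frobCode Fq hn,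
        ← Submodule.map_inf _ hinj, ← Submodule.map_inf _ hinj,
        finrank_map_qcompRight Fq hn p hp,
        twistedGabidulin_inf_frobCode_inf_frobCode Fq hn hs hk hkn hη',
        finrank_qmonoSpan (by omega) hs (by omega)]
    · rw [map_qcompRight_twistedGabidulin Fq hn]
      exact Submodule.mem_sup_right (Submodule.mem_span_singleton_self _)
  · rintro ⟨s, hs, -, -, p, q, -, hpq, hp, η, hη, hnorm, hmem⟩
    have hC : (twistedGabidulin n k s η).map (qcompRight Fq p) = C := by
      rw [map_qcompRight_twistedGabidulin Fq hn]
      refine Submodule.eq_of_le_of_finrank_eq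
        (sup_le (hpq ▸ le_sup_left) ((Submodule.span_singleton_le_iff_mem _ _).2 hmem)) ?_
      rw [finrank_qchain_sup_twist Fq hn hs (by omega) (by omega) p hp, hdim]
    exact ⟨s, η, hs, hη, hnorm, hC ▸ codeEquiv_twistedGabidulin Fq hn p hp η⟩
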